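/- arXiv:1803.01584 — 6 statements merged into one kernel-verified Lean document; each statement's English description precedes it below -/
import Mathlib

section
/- Let E be a field of characteristic zero and let e ≥ 2. The polynomial d = ∏_{1 ≤ i < j ≤ e} (X_i − X_j)^2 is a symmetric polynomial, and as an element of the subalgebra S of symmetric polynomials of E[X_1,…,X_e] it is irreducible. -/
namespace MvPolynomial

section CommRing

variable {ι R : Type*} [CommRing R]

theorem X_sub_X_dvd_sub_aeval_update [DecidableEq ι] (i j : ι) (f : MvPolynomial ι R) :
    X i - X j ∣ f - aeval (Function.update X i (X j)) f := by
  induction f using MvPolynomial.induction_on with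
  | C a => simp
  | add p q hp hq =>
    rw [map_add, add_sub_add_comm]
    exact dvd_add hp hq
  | mul_X p k hp =>
    rw [map_mul, aeval_X]
    refine dvd_mul_sub_mul hp ?_
    by_cases hk : k = i
    · subst hk
      simp
    · simp [Function.update_of_ne hk]

theorem X_sub_X_dvd_iff [DecidableEq ι] (i j : ι) (f : MvPolynomial ι R) :
    X i - X j ∣ f ↔ aeval (Function.update X i (X j)) f = (0 : MvPolynomial ι R) := by
  constructor
  · rintro ⟨g, rfl⟩
    by_cases h : j = i
    · simp [h]
    · simp [Function.update_of_ne h]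
  · intro h
    simpa only [h, sub_zero] using X_sub_X_dvd_sub_aeval_update i j f

theorem prime_X_sub_X [IsDomain R] {i j : ι} (hij : i ≠ j) :
    Prime (X i - X j : MvPolynomial ι R) := by
  classical
  refine ⟨sub_ne_zero.mpr fun h => hij (X_injective h), fun h => ?_, fun a b h => ?_⟩
  · have := (X_sub_X_dvd_iff i j (1 : MvPolynomial ι R)).mp h.dvd
    simp at this
  · simpa only [X_sub_X_dvd_iff, map_mul, mul_eq_zero] using h

theorem IsSymmetric.X_sub_X_dvd {f : MvPolynomial ι R} (hf : f.IsSymmetric) {i j k l : ι}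
    (hij : i ≠ j) (hkl : k ≠ l) (h : X i - X j ∣ f) : X k - X l ∣ f := by
  classical
  let σ : Equiv.Perm ι := Equiv.swap (Equiv.swap i k j) l * Equiv.swap i k
  have hσj : σ j = l := by simp [σ]
  have hσi : σ i = k := by
    have hne : k ≠ Equiv.swap i k j := by
      intro hk
      exact hij ((Equiv.swap i k).injective (by rw [← hk, Equiv.swap_apply_left]))
    simp only [σ, Equiv.Perm.mul_apply, Equiv.swap_apply_left]
    exact Equiv.swap_apply_of_ne_of_ne hne hkl
  have := map_dvd (rename (R := R) σ) h
  rwa [hf σ, map_sub, rename_X, rename_X, hσi, hσj] at this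

theorem IsSymmetric.X_sub_X_sq_dvd [IsDomain R] [CharZero R] {f : MvPolynomial ι R}
    (hf : f.IsSymmetric) {i j : ι} (hij : i ≠ j) (h : X i - X j ∣ f) :
    (X i - X j) ^ 2 ∣ f := by
  classical
  obtain ⟨g, rfl⟩ := h
  have hswap := hf (Equiv.swap i j)
  simp only [map_mul, map_sub, rename_X, Equiv.swap_apply_left, Equiv.swap_apply_right] at hswap
  have hg : rename (Equiv.swap i j) g = -g :=
    mul_left_cancel₀ (prime_X_sub_X hij).ne_zero (by linear_combination -hswap)
  have hcomp : (Function.update X i (X j) : ι → MvPolynomial ι R) ∘ Equiv.swap i j =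
      Function.update X i (X j) := by
    funext k
    by_cases hi : k = i
    · subst hi
      simp [Function.update_of_ne hij.symm]
    by_cases hj : k = j
    · subst hj
      simp [Function.update_of_ne hi]
    · simp [Equiv.swap_apply_of_ne_of_ne hi hj]
  have hev := congrArg (aeval (Function.update X i (X j) : ι → MvPolynomial ι R)) hg
  rw [aeval_rename, hcomp, map_neg, self_eq_neg] at hev
  rw [sq]
  exact mul_dvd_mul_left _ ((X_sub_X_dvd_iff i j g).mpr hev)

theorem isSymmetric_prod_X_sub_X_sq (n : ℕ) :
    (∏ i : Fin n, ∏ j ∈ Finset.Ioi i, (X i - X j : MvPolynomial (Fin n) R) ^ 2).IsSymmetric := by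
  have hdet : (∏ i : Fin n, ∏ j ∈ Finset.Ioi i, (X i - X j : MvPolynomial (Fin n) R) ^ 2) =
      (Matrix.vandermonde (X : Fin n → MvPolynomial (Fin n) R)).det ^ 2 := by
    simp_rw [Matrix.det_vandermonde, ← Finset.prod_pow]
    exact Finset.prod_congr rfl fun i _ => Finset.prod_congr rfl fun j _ => sub_sq_comm _ _
  intro σ
  have hσ : (rename (R := R) σ).mapMatrix (Matrix.vandermonde X) =
      (Matrix.vandermonde (X : Fin n → MvPolynomial (Fin n) R)).submatrix σ id := by
    ext1 i j
    simp [Matrix.vandermonde_apply]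
  rw [hdet, map_pow, AlgHom.map_det, hσ, Matrix.det_permute, mul_pow, ← Int.cast_pow,
    ← Units.val_pow_eq_pow_val, Int.units_sq]
  simp

/-- A nontrivial difference of variables divides the product of the squared differences
exactly twice. -/
theorem not_X_sub_X_pow_four_dvd_prod [IsDomain R] [CharZero R] {n : ℕ} {a b : Fin n}
    (hab : a < b) :
    ¬ ((X a - X b) ^ 2 * (X a - X b) ^ 2 ∣
      ∏ i : Fin n, ∏ j ∈ Finset.Ioi i, (X i - X j : MvPolynomial (Fin n) R) ^ 2) := by
  classical
  intro h
  have hp := prime_X_sub_X (R := R) hab.ne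
  have hmem : (⟨a, b⟩ : Σ _ : Fin n, Fin n) ∈ Finset.univ.sigma Finset.Ioi := by simpa using hab
  rw [Finset.prod_sigma', ← Finset.mul_prod_erase _ _ hmem,
    mul_dvd_mul_iff_left (pow_ne_zero 2 hp.ne_zero)] at h
  obtain ⟨⟨i, j⟩, hij, hdvd⟩ :=
    (hp.dvd_finsetProd_iff _).mp ((dvd_pow_self _ two_ne_zero).trans h)
  simp only [Finset.mem_erase, Finset.mem_sigma, Finset.mem_univ, Finset.mem_Ioi, true_and] at hij
  obtain ⟨hne, hlt⟩ := hij
  have := (X_sub_X_dvd_iff a b _).mp (hp.dvd_of_dvd_pow hdvd)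
  simp only [map_sub, aeval_X, sub_eq_zero, Function.update_apply] at this
  split_ifs at this with h1 h2 h2
  · exact hlt.ne (h1.trans h2.symm)
  · exact hne (by rw [h1, X_injective this])
  · have := X_injective this
    omega
  · exact hlt.ne (X_injective this)

end CommRing

section Field

variable {ι E : Type*} [Field E]

theorem isUnit_symmetricSubalgebra_iff {f : symmetricSubalgebra ι E} :
    IsUnit f ↔ IsUnit (f : MvPolynomial ι E) := by
  refine ⟨fun h => h.map (symmetricSubalgebra ι E).val, fun h => ?_⟩
  obtain ⟨r, hr, hf⟩ := isUnit_iff_eq_C_of_isReduced.mp h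
  have : f = algebraMap E (symmetricSubalgebra ι E) r := Subtype.ext hf
  rw [this]
  exact hr.map _

theorem exists_X_sub_X_dvd_of_dvd_prod {n : ℕ} {f : MvPolynomial (Fin n) E} (hf : ¬ IsUnit f)
    (hdvd : f ∣ ∏ i : Fin n, ∏ j ∈ Finset.Ioi i, (X i - X j : MvPolynomial (Fin n) E) ^ 2) :
    ∃ i j : Fin n, i ≠ j ∧ X i - X j ∣ f := by
  have hd : (∏ i : Fin n, ∏ j ∈ Finset.Ioi i, (X i - X j : MvPolynomial (Fin n) E) ^ 2) ≠ 0 :=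
    Finset.prod_ne_zero_iff.mpr fun i _ => Finset.prod_ne_zero_iff.mpr fun j hj =>
      pow_ne_zero 2 (prime_X_sub_X (Finset.mem_Ioi.mp hj).ne).ne_zero
  obtain ⟨q, hq, hqf⟩ := WfDvdMonoid.exists_irreducible_factor hf (ne_zero_of_dvd_ne_zero hd hdvd)
  obtain ⟨i, -, hi⟩ := (hq.prime.dvd_finsetProd_iff _).mp (hqf.trans hdvd)
  obtain ⟨j, hj, hij⟩ := (hq.prime.dvd_finsetProd_iff _).mp hi
  have hne : i ≠ j := (Finset.mem_Ioi.mp hj).ne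
  have hassoc := hq.associated_of_dvd (prime_X_sub_X hne).irreducible
    (hq.prime.dvd_of_dvd_pow hij)
  exact ⟨i, j, hne, hassoc.symm.dvd.trans hqf⟩

end Field

end MvPolynomial

/-- The polynomial `d = ∏_{i < j} (X i - X j)^2` is a symmetric polynomial,
and as an element of the subalgebra of symmetric polynomials it is irreducible. -/
theorem discriminant_polynomial_symmetric_and_irreducible
    (E : Type*) [Field E] [CharZero E] (e : ℕ) (he : 2 ≤ e) :
    ∃ hd : (∏ i : Fin e, ∏ j ∈ Finset.Ioi i, (MvPolynomial.X i - MvPolynomial.X j) ^ 2)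
        ∈ MvPolynomial.symmetricSubalgebra (Fin e) E,
      Irreducible
        (⟨∏ i : Fin e, ∏ j ∈ Finset.Ioi i, (MvPolynomial.X i - MvPolynomial.X j) ^ 2, hd⟩ :
          MvPolynomial.symmetricSubalgebra (Fin e) E) := by
  open MvPolynomial in
  refine ⟨isSymmetric_prod_X_sub_X_sq e, ?_⟩
  let a : Fin e := ⟨0, by omega⟩
  let b : Fin e := ⟨1, by omega⟩
  have hab : a < b := Nat.zero_lt_one
  have key : ∀ f : symmetricSubalgebra (Fin e) E, ¬ IsUnit f →
      (f : MvPolynomial (Fin e) E) ∣ ∏ i : Fin e, ∏ j ∈ Finset.Ioi i, (X i - X j) ^ 2 →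
      (X a - X b) ^ 2 ∣ (f : MvPolynomial (Fin e) E) := by
    intro f hf hdvd
    obtain ⟨i, j, hij, h⟩ :=
      exists_X_sub_X_dvd_of_dvd_prod (mt isUnit_symmetricSubalgebra_iff.mpr hf) hdvd
    have hsymm : (f : MvPolynomial (Fin e) E).IsSymmetric := f.2
    exact hsymm.X_sub_X_sq_dvd hab.ne (hsymm.X_sub_X_dvd hij hab.ne h)
  refine ⟨fun h => ?_, fun f g hfg => ?_⟩
  · refine (prime_X_sub_X (R := E) hab.ne).not_isUnit
      (isUnit_of_dvd_unit ?_ (isUnit_symmetricSubalgebra_iff.mp h))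
    exact (dvd_pow_self _ two_ne_zero).trans
      ((Finset.dvd_prod_of_mem (fun j => (X a - X j : MvPolynomial (Fin e) E) ^ 2)
        (Finset.mem_Ioi.mpr hab)).trans
      (Finset.dvd_prod_of_mem (fun i => ∏ j ∈ Finset.Ioi i,
        (X i - X j : MvPolynomial (Fin e) E) ^ 2) (Finset.mem_univ a)))
  · have hfg' := congrArg Subtype.val hfg
    by_contra! hu
    refine not_X_sub_X_pow_four_dvd_prod (R := E) hab ?_
    have hf := key f hu.1 (Dvd.intro _ hfg'.symm)
    have hg := key g hu.2 (Dvd.intro_left _ hfg'.symm)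
    exact (mul_dvd_mul hf hg).trans (Dvd.intro _ (by rw [mul_one]; exact hfg'.symm))
end

section
/- Let E be a field of characteristic zero and let e ≥ 2. Let Z = E[X_1,…,X_e] and let S be its subalgebra of symmetric polynomials, so that Z is a finite free S-module with basis the monomials X^ν = X_1^{ν(1)} ⋯ X_e^{ν(e)} with 0 ≤ ν(i) < i for 1 ≤ i ≤ e. Let Δ = det( Tr_{Z/S}(X^μ · X^ν) )_{μ,ν} be the determinant of the matrix of traces of products of these basis monomials (in Lean, Algebra.discr S applied to this family of monomials), and let d = ∏_{1 ≤ i < j ≤ e} (X_i − X_j)^2, regarded as an element of S. Then Δ is, up to a unit of S, a power of d; that is, there exists n : ℕ such that Δ and d^n are associated elements of S. -/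
open Finset in
theorem Fin.prod_prod_Ioi_succAbove {M : Type*} [CommMonoid M] {n : ℕ}
    (F : Fin (n + 1) → Fin (n + 1) → M) :
    ∏ j : Fin (n + 1), ∏ i : Fin n, ∏ k ∈ Ioi i, F (j.succAbove i) (j.succAbove k) =
      (∏ i, ∏ k ∈ Ioi i, F i k) ^ (n - 1) := by
  have hIoi (m : ℕ) (i : Fin m) (f : Fin m → M) :
      ∏ k ∈ Ioi i, f k = ∏ k, if i < k then f k else 1 := by
    rw [← prod_filter]
    congr 1
    ext
    simp
  have hsucc (j : Fin (n + 1)) (f : Fin (n + 1) → M) :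
      ∏ i, f (j.succAbove i) = ∏ a, if a = j then 1 else f a := by
    rw [Fin.prod_univ_succAbove _ j]
    simp
  simp only [hIoi]
  have key (j : Fin (n + 1)) :
      (∏ i : Fin n, ∏ k, if i < k then F (j.succAbove i) (j.succAbove k) else 1) =
        ∏ a, ∏ b, if a = j ∨ b = j then 1 else if a < b then F a b else 1 := by
    calc _ = ∏ i : Fin n, ∏ b, if b = j then 1 else
              if j.succAbove i < b then F (j.succAbove i) b else 1 := by
            refine prod_congr rfl fun i _ => ?_
            rw [← hsucc j fun b => if j.succAbove i < b then F (j.succAbove i) b else 1]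
            simp
      _ = _ := by
            rw [hsucc j fun a => ∏ b, if b = j then 1 else if a < b then F a b else 1]
            refine prod_congr rfl fun a _ => ?_
            by_cases h : a = j <;> simp [h]
  simp only [key]
  rw [prod_comm, ← prod_pow]
  refine prod_congr rfl fun a _ => ?_
  rw [prod_comm, ← prod_pow]
  refine prod_congr rfl fun b _ => ?_
  by_cases hab : a < b
  · simp only [hab, if_true]
    rw [prod_ite, prod_const_one, one_mul, Finset.prod_const]
    have : ({j | ¬ (a = j ∨ b = j)} : Finset (Fin (n + 1))) = ({a, b} : Finset _)ᶜ := by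
      ext j
      simp [eq_comm]
    rw [this, card_compl, card_pair hab.ne, Fintype.card_fin]
    congr 1
  · simp [hab]

theorem Matrix.det_submatrix_equiv_sq {m n R : Type*} [Fintype m] [DecidableEq m] [Fintype n]
    [DecidableEq n] [CommRing R] (e f : n ≃ m) (A : Matrix m m R) :
    (A.submatrix e f).det ^ 2 = A.det ^ 2 := by
  have : A.submatrix e f = ((A.submatrix f f).submatrix (e.trans f.symm) id) := by
    ext; simp
  rw [this, det_permute, det_submatrix_equiv_self, mul_pow, ← Int.cast_pow,
    ← Units.val_pow_eq_pow_val]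
  simp

theorem Fin.prod_succAbove_det_vandermonde_sq {R : Type*} [CommRing R] {n : ℕ}
    (x : Fin (n + 1) → R) :
    ∏ j : Fin (n + 1), (Matrix.vandermonde fun i => x (j.succAbove i)).det ^ 2 =
      ((Matrix.vandermonde x).det ^ 2) ^ (n - 1) := by
  simp only [Matrix.det_vandermonde, Finset.prod_pow]
  rw [Fin.prod_prod_Ioi_succAbove fun i k => x k - x i]
  ring

/-- The permutation of `Fin (n + 1)` that sends `Fin.last n` to `j` and acts on the other points
as `σ`, through `Fin.succAbove j`. -/
noncomputable def Equiv.Perm.ofLast {n : ℕ} (j : Fin (n + 1)) (σ : Equiv.Perm (Fin n)) :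
    Equiv.Perm (Fin (n + 1)) :=
  Equiv.ofBijective (Fin.snoc (fun i => j.succAbove (σ i)) j : Fin (n + 1) → Fin (n + 1)) <| by
    rw [← Finite.injective_iff_bijective]
    intro a b
    induction a using Fin.lastCases <;> induction b using Fin.lastCases <;>
      simp [Fin.succAbove_ne, Fin.ne_succAbove]

@[simp]
theorem Equiv.Perm.ofLast_castSucc {n : ℕ} (j : Fin (n + 1)) (σ : Equiv.Perm (Fin n)) (i : Fin n) :
    Equiv.Perm.ofLast j σ i.castSucc = j.succAbove (σ i) := by
  simp [ofLast]

@[simp]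
theorem Equiv.Perm.ofLast_last {n : ℕ} (j : Fin (n + 1)) (σ : Equiv.Perm (Fin n)) :
    Equiv.Perm.ofLast j σ (Fin.last n) = j := by
  simp [ofLast]

theorem Equiv.Perm.ofLast_bijective (n : ℕ) :
    Function.Bijective fun p : Equiv.Perm (Fin n) × Fin (n + 1) => Equiv.Perm.ofLast p.2 p.1 := by
  rw [Fintype.bijective_iff_injective_and_card]
  constructor
  · rintro ⟨σ, j⟩ ⟨τ, k⟩ h
    have hjk : j = k := by simpa using DFunLike.congr_fun h (Fin.last n)
    subst hjk
    have : σ = τ := Equiv.ext fun i => by simpa using DFunLike.congr_fun h i.castSucc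
    rw [this]
  · simp [Fintype.card_perm, Nat.factorial_succ, mul_comm]

theorem card_staircase (n : ℕ) :
    Fintype.card ((i : Fin n) → Fin (i.1 + 1)) = n.factorial := by
  simp [Fintype.card_pi, Fin.prod_univ_eq_prod_range (fun i => i + 1),
    Finset.prod_range_add_one_eq_factorial]

/-- The determinant of the monomials `∏ i, x (σ i) ^ ν i` with `ν i ≤ i`, indexed by permutations `σ`
and exponents `ν`, is up to sign a power of the Vandermonde determinant. -/
theorem exists_det_perm_monomial_sq_eq_pow (n : ℕ) :
    ∃ N : ℕ, ∀ {R : Type*} [CommRing R] (x : Fin n → R)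
      {ι : Type} [Fintype ι] [DecidableEq ι]
      (a : ι ≃ Equiv.Perm (Fin n)) (b : ι ≃ ((i : Fin n) → Fin (i.1 + 1))),
      (Matrix.of fun s t => ∏ i, x (a s i) ^ (b t i : ℕ)).det ^ 2 =
        ((Matrix.vandermonde x).det ^ 2) ^ N := by
  induction n with
  | zero =>
    refine ⟨0, fun x ι _ _ a b => ?_⟩
    have : (Matrix.of fun s t => ∏ i, x (a s i) ^ (b t i : ℕ)) =
        (1 : Matrix (Equiv.Perm (Fin 0)) (Equiv.Perm (Fin 0)) _).submatrix a a := by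
      ext s t
      simp [Matrix.one_apply, Subsingleton.elim (a s) (a t)]
    rw [this, Matrix.det_submatrix_equiv_sq]
    simp
  | succ n ih =>
    obtain ⟨N, hN⟩ := ih
    refine ⟨(n - 1) * N + n.factorial, fun x ι _ _ a b => ?_⟩
    let P := Equiv.Perm (Fin n)
    let c : P ≃ ((i : Fin n) → Fin (i.1 + 1)) :=
      Fintype.equivOfCardEq (by rw [card_staircase, Fintype.card_perm, Fintype.card_fin])
    let a' : P × Fin (n + 1) ≃ Equiv.Perm (Fin (n + 1)) :=
      Equiv.ofBijective _ (Equiv.Perm.ofLast_bijective n)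
    let b' : P × Fin (n + 1) ≃ ((i : Fin (n + 1)) → Fin (i.1 + 1)) :=
      ((Equiv.prodComm _ _).trans ((Equiv.refl _).prodCongr c)).trans
        (Fin.snocEquiv fun i : Fin (n + 1) => Fin (i.1 + 1))
    let M (j : Fin (n + 1)) : Matrix P P _ :=
      Matrix.of fun s t => ∏ i, x (j.succAbove (s i)) ^ (c t i : ℕ)
    have hM : (Matrix.of fun s t => ∏ i, x (a s i) ^ (b t i : ℕ)) =
        (Matrix.blockDiagonal M *
          Matrix.kroneckerMap (fun p q => p * q) (1 : Matrix P P _)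
            (Matrix.vandermonde x)).submatrix (a.trans a'.symm) (b.trans b'.symm) := by
      ext s t
      obtain ⟨⟨σ, j⟩, hs⟩ := (a.trans a'.symm).symm.surjective s |>.imp fun _ h => h.symm
      obtain ⟨⟨τ, k⟩, ht⟩ := (b.trans b'.symm).symm.surjective t |>.imp fun _ h => h.symm
      subst hs ht
      have h1 : a ((a.trans a'.symm).symm (σ, j)) = Equiv.Perm.ofLast j σ := by simp [a']
      have h2 : b ((b.trans b'.symm).symm (τ, k)) = b' (τ, k) := by simp
      have h3 (i : Fin n) : (b' (τ, k) i.castSucc : ℕ) = c τ i := by simp [b', Fin.snocEquiv]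
      have h4 : (b' (τ, k) (Fin.last n) : ℕ) = k := by simp [b', Fin.snocEquiv]
      simp only [Matrix.of_apply, Matrix.submatrix_apply, h1, h2, Equiv.apply_symm_apply,
        Matrix.mul_apply, Fin.prod_univ_castSucc, h3, h4, Fintype.sum_prod_type]
      simp [Matrix.blockDiagonal_apply, Matrix.one_apply, Matrix.vandermonde_apply, M]
    rw [hM, Matrix.det_submatrix_equiv_sq, Matrix.det_mul, Matrix.det_blockDiagonal,
      Matrix.det_kronecker, mul_pow, ← Finset.prod_pow]
    have hMj (j : Fin (n + 1)) := hN (fun i => x (j.succAbove i)) (Equiv.refl P) c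
    simp only [Equiv.refl_apply] at hMj
    simp only [M, hMj, Finset.prod_pow]
    have := Fin.prod_succAbove_det_vandermonde_sq x
    rw [Finset.prod_pow] at this
    rw [this]
    simp [P, Fintype.card_perm]
    ring

section

universe u

open Polynomial

theorem exists_eq_sum_pow_of_mem_adjoin_singleton {R A : Type*} [CommRing R] [CommRing A]
    [Algebra R A] {n : ℕ} {p : R[X]} (hp : p.Monic) (hn : p.natDegree = n + 1) {y c : A}
    (hy : aeval y p = 0) (hc : c ∈ Algebra.adjoin R {y}) :
    ∃ r : ℕ → R, c = ∑ k ∈ Finset.range (n + 1), r k • y ^ k := by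
  rw [Algebra.adjoin_singleton_eq_range_aeval] at hc
  obtain ⟨f, rfl⟩ := hc
  have hlt : (f %ₘ p).natDegree < n + 1 := by
    rw [← hn]
    exact natDegree_modByMonic_lt _ hp fun h => by simp [h] at hn
  refine ⟨(f %ₘ p).coeff, ?_⟩
  rw [← aeval_eq_sum_range' hlt]
  change aeval y f = _
  conv_lhs => rw [← modByMonic_add_div f p]
  simp [hy]

theorem mem_adjoin_range_castSucc {R B A : Type*} [CommRing R] [CommRing B] [CommRing A]
    [Algebra R A] [Algebra R B] [Algebra B A] [IsScalarTower R B A] {n : ℕ} (x : Fin (n + 1) → A)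
    (hx : x (Fin.last n) ∈ Set.range (algebraMap B A)) {a : A}
    (ha : a ∈ Algebra.adjoin R (Set.range x)) :
    a ∈ Algebra.adjoin B (Set.range fun i : Fin n => x i.castSucc) := by
  set T := Algebra.adjoin B (Set.range fun i : Fin n => x i.castSucc) with hT
  have hxT (i : Fin (n + 1)) : x i ∈ T := by
    induction i using Fin.lastCases with
    | last =>
      obtain ⟨z, hz⟩ := hx
      rw [← hz]
      exact T.algebraMap_mem z
    | cast i =>
      rw [hT]
      exact Algebra.subset_adjoin (Set.mem_range_self i)
  have hle : Algebra.adjoin R (Set.range x) ≤ T.restrictScalars R :=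
    Algebra.adjoin_le (Set.range_subset_iff.2 hxT)
  exact hle ha

/-- If `∏ i, (X - x i)` has coefficients in `R`, then `R[x]` is spanned over `R` by the monomials
`∏ i, x i ^ ν i` with `ν i ≤ i`. -/
theorem mem_span_monomials_of_lifts (n : ℕ) :
    ∀ {R A : Type u} [CommRing R] [CommRing A] [Algebra R A] (x : Fin n → A),
      (∏ i, (X - C (x i))) ∈ lifts (algebraMap R A) →
      ∀ a ∈ Algebra.adjoin R (Set.range x),
        a ∈ Submodule.span R
          (Set.range fun ν : (i : Fin n) → Fin (i.1 + 1) => ∏ i, x i ^ (ν i : ℕ)) := by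
  induction n with
  | zero =>
    intro R A _ _ _ x _ a ha
    have hx : Set.range x = ∅ := Set.range_eq_empty x
    rw [hx, Algebra.adjoin_empty, Algebra.mem_bot] at ha
    obtain ⟨r, rfl⟩ := ha
    rw [Algebra.algebraMap_eq_smul_one]
    exact Submodule.smul_mem _ _ (Submodule.subset_span ⟨fun i => 0, by simp⟩)
  | succ n ih =>
    intro R A _ _ _ x hx a ha
    rcases subsingleton_or_nontrivial A with _ | _
    · rw [Subsingleton.elim a 0]
      exact zero_mem _
    let y := x (Fin.last n)
    let B := Algebra.adjoin R {y}
    have hmonic : (∏ i, (X - C (x i))).Monic := monic_prod_of_monic _ _ fun i _ => monic_X_sub_C _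
    have hlift : (∏ i : Fin n, (X - C (x i.castSucc))) ∈ lifts (algebraMap B A) := by
      obtain ⟨p, hp⟩ := (mem_lifts _).1 hx
      let z : B := ⟨y, Algebra.self_mem_adjoin_singleton R y⟩
      refine (mem_lifts _).2 ⟨p.map (algebraMap R B) /ₘ (X - C z), ?_⟩
      rw [map_divByMonic _ (monic_X_sub_C z), map_map, ← IsScalarTower.algebraMap_eq, hp,
        Fin.prod_univ_castSucc, mul_comm, Polynomial.map_sub, map_X, map_C]
      exact mul_divByMonic_cancel_left _ (monic_X_sub_C _)
    have haB : a ∈ Algebra.adjoin B (Set.range fun i : Fin n => x i.castSucc) :=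
      mem_adjoin_range_castSucc x ⟨⟨y, Algebra.self_mem_adjoin_singleton R y⟩, rfl⟩ ha
    have hB (c : B) : ∃ r : ℕ → R, (c : A) = ∑ k ∈ Finset.range (n + 1), r k • y ^ k := by
      obtain ⟨p, hp, hdeg, hpm⟩ := lifts_and_natDegree_eq_and_monic hx hmonic
      have hpn : p.natDegree = n + 1 := by
        rw [hdeg, natDegree_prod_of_monic _ _ fun i _ => monic_X_sub_C _]
        simp
      have hpy : aeval y p = 0 := by
        rw [← eval_map_algebraMap, hp, eval_prod]
        exact Finset.prod_eq_zero (Finset.mem_univ (Fin.last n)) (by simp [y])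
      exact exists_eq_sum_pow_of_mem_adjoin_singleton hpm hpn hpy c.2
    obtain ⟨c, hc⟩ := (Submodule.mem_span_range_iff_exists_fun B).1 (ih _ hlift a haB)
    rw [← hc]
    refine Submodule.sum_mem _ fun ν _ => ?_
    obtain ⟨r, hr⟩ := hB (c ν)
    rw [Subalgebra.smul_def, hr, smul_eq_mul, Finset.sum_mul]
    refine Submodule.sum_mem _ fun k hk => ?_
    rw [smul_mul_assoc]
    refine Submodule.smul_mem _ _ (Submodule.subset_span
      ⟨Fin.snoc (α := fun i : Fin (n + 1) => Fin (i.1 + 1)) ν ⟨k, Finset.mem_range.1 hk⟩, ?_⟩)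
    simp [Fin.prod_univ_castSucc, mul_comm, y]

end

theorem Algebra.algebraMap_trace_eq_sum {S Z ι : Type*} [CommRing S] [CommRing Z] [IsDomain Z]
    [Algebra S Z] [Fintype ι] [DecidableEq ι] (b : Module.Basis ι S Z) (σ : ι → Z →ₐ[S] Z)
    (hdet : (Matrix.of fun i j => σ i (b j)).det ≠ 0) (z : Z) :
    algebraMap S Z (Algebra.trace S Z z) = ∑ i, σ i z := by
  set M : Matrix ι ι Z := Matrix.of fun i j => σ i (b j)
  set L := (Algebra.leftMulMatrix b z).map (algebraMap S Z)
  have hML : Matrix.diagonal (fun i => σ i z) * M = M * L := by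
    ext i j
    rw [Matrix.diagonal_mul, Matrix.mul_apply]
    simp only [M, L, Matrix.of_apply, Matrix.map_apply]
    rw [← map_mul]
    conv_lhs => rw [← b.sum_repr (z * b j)]
    simp [Algebra.leftMulMatrix_eq_repr_mul, Algebra.smul_def, mul_comm]
  apply mul_left_cancel₀ hdet
  calc M.det * algebraMap S Z (Algebra.trace S Z z)
      = M.det * L.trace := by
        rw [Algebra.trace_eq_matrix_trace b]
        simp [L, Matrix.trace]
    _ = (M * L * M.adjugate).trace := by
        rw [Matrix.trace_mul_comm, ← mul_assoc, Matrix.adjugate_mul]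
        simp
    _ = M.det * ∑ i, σ i z := by
        rw [← hML, mul_assoc, Matrix.mul_adjugate]
        simp [Matrix.trace_diagonal]

theorem Algebra.algebraMap_discr_eq_det_sq {S Z ι : Type*} [CommRing S] [CommRing Z] [IsDomain Z]
    [Algebra S Z] [Fintype ι] [DecidableEq ι] (b : Module.Basis ι S Z) (σ : ι → Z →ₐ[S] Z)
    (hdet : (Matrix.of fun i j => σ i (b j)).det ≠ 0) :
    algebraMap S Z (Algebra.discr S b) = (Matrix.of fun i j => σ i (b j)).det ^ 2 := by
  set M : Matrix ι ι Z := Matrix.of fun i j => σ i (b j)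
  have : (Algebra.traceMatrix S b).map (algebraMap S Z) = M.transpose * M := by
    ext i j
    simp [Algebra.traceMatrix_apply, Algebra.traceForm_apply, Matrix.mul_apply, M,
      Algebra.algebraMap_trace_eq_sum b σ hdet]
  rw [Algebra.discr_def, RingHom.map_det, RingHom.mapMatrix_apply, this, Matrix.det_mul,
    Matrix.det_transpose, sq]

theorem linearIndependent_of_det_algHom_ne_zero {S Z ι : Type*} [CommRing S] [CommRing Z]
    [IsDomain Z] [Algebra S Z] [FaithfulSMul S Z] [Fintype ι] [DecidableEq ι] (v : ι → Z)
    (σ : ι → Z →ₐ[S] Z) (hdet : (Matrix.of fun i j => σ i (v j)).det ≠ 0) :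
    LinearIndependent S v := by
  rw [Fintype.linearIndependent_iff]
  intro g hg i
  have h0 : (Matrix.of fun i j => σ i (v j)).mulVec (fun j => algebraMap S Z (g j)) = 0 := by
    ext i
    have := congrArg (σ i) hg
    simpa [Matrix.mulVec, dotProduct, Algebra.smul_def, mul_comm] using this
  have := congrFun (Matrix.eq_zero_of_mulVec_eq_zero hdet h0) i
  exact FaithfulSMul.algebraMap_injective S Z (by simpa using this)

/-- Renaming the variables along a permutation, as an algebra map over the symmetric polynomials. -/
noncomputable def MvPolynomial.renameSymmetric (τ E : Type*) [CommRing E] (σ : Equiv.Perm τ) :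
    MvPolynomial τ E →ₐ[symmetricSubalgebra τ E] MvPolynomial τ E :=
  { (rename σ : MvPolynomial τ E →ₐ[E] MvPolynomial τ E).toRingHom with
    commutes' := fun s => s.2 σ }

@[simp]
theorem MvPolynomial.renameSymmetric_X (τ E : Type*) [CommRing E] (σ : Equiv.Perm τ) (i : τ) :
    renameSymmetric τ E σ (X i) = X (σ i) :=
  rename_X σ i

theorem MvPolynomial.prod_X_sub_C_mem_lifts (τ E : Type*) [Fintype τ] [CommRing E] :
    (∏ i, (Polynomial.X - Polynomial.C (X i : MvPolynomial τ E))) ∈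
      Polynomial.lifts (algebraMap (symmetricSubalgebra τ E) (MvPolynomial τ E)) := by
  rw [Polynomial.lifts_iff_coeff_lifts]
  intro k
  set p := ∏ i, (Polynomial.X - Polynomial.C (X i : MvPolynomial τ E)) with hp
  have hsymm : (p.coeff k).IsSymmetric := fun σ => by
    have h : p.map (rename σ : MvPolynomial τ E →ₐ[E] MvPolynomial τ E).toRingHom = p := by
      rw [hp, Polynomial.map_prod]
      simp [Equiv.prod_comp σ fun i => Polynomial.X - Polynomial.C (X i : MvPolynomial τ E)]
    conv_rhs => rw [← h]
    rw [Polynomial.coeff_map]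
    rfl
  exact ⟨⟨_, hsymm⟩, rfl⟩

theorem MvPolynomial.span_symmetricSubalgebra_monomials (E : Type*) [CommRing E] (n : ℕ) :
    Submodule.span (symmetricSubalgebra (Fin n) E)
      (Set.range fun ν : (i : Fin n) → Fin (i.1 + 1) =>
        (∏ i, X i ^ (ν i : ℕ) : MvPolynomial (Fin n) E)) = ⊤ := by
  rw [eq_top_iff]
  intro a _
  refine mem_span_monomials_of_lifts n _ (prod_X_sub_C_mem_lifts (Fin n) E) a ?_
  have h : Algebra.adjoin E (Set.range X) ≤
      (Algebra.adjoin (symmetricSubalgebra (Fin n) E)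
        (Set.range (X : Fin n → MvPolynomial (Fin n) E))).restrictScalars E :=
    Algebra.adjoin_le Algebra.subset_adjoin
  rw [adjoin_range_X] at h
  exact h trivial

/-- The discriminant `Δ = det (Tr_{Z/S} (X^μ · X^ν))_{μ,ν}` of the basis of
monomials `X^ν` (with `0 ≤ ν i ≤ i`) of `Z = E[X_1, …, X_e]` over the subalgebra `S` of
symmetric polynomials is, up to a unit, a power of `d = ∏_{i < j} (X i - X j)^2 ∈ S`. -/
theorem discr_associated_pow_of_discriminant_polynomial
    (E : Type*) [Field E] [CharZero E] (e : ℕ) (he : 2 ≤ e)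
    (hd : (∏ i : Fin e, ∏ j ∈ Finset.Ioi i, (MvPolynomial.X i - MvPolynomial.X j) ^ 2)
        ∈ MvPolynomial.symmetricSubalgebra (Fin e) E) :
    ∃ n : ℕ,
      Associated
        (Algebra.discr (MvPolynomial.symmetricSubalgebra (Fin e) E)
          (fun ν : (i : Fin e) → Fin (i.1 + 1) =>
            (∏ i, MvPolynomial.X i ^ (ν i : ℕ) : MvPolynomial (Fin e) E)))
        ((⟨∏ i : Fin e, ∏ j ∈ Finset.Ioi i, (MvPolynomial.X i - MvPolynomial.X j) ^ 2, hd⟩ :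
          MvPolynomial.symmetricSubalgebra (Fin e) E) ^ n) := by
  obtain ⟨N, hN⟩ := exists_det_perm_monomial_sq_eq_pow e
  let S := MvPolynomial.symmetricSubalgebra (Fin e) E
  let Z := MvPolynomial (Fin e) E
  let ι := (i : Fin e) → Fin (i.1 + 1)
  let v : ι → Z := fun ν => ∏ i, MvPolynomial.X i ^ (ν i : ℕ)
  let c : ι ≃ Equiv.Perm (Fin e) := Fintype.equivOfCardEq (by
    rw [card_staircase, Fintype.card_perm, Fintype.card_fin])
  let σ : ι → Z →ₐ[S] Z := fun μ => MvPolynomial.renameSymmetric (Fin e) E (c μ)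
  have hdet : (Matrix.of fun i j => σ i (v j)).det ^ 2 =
      ((Matrix.vandermonde (MvPolynomial.X : Fin e → Z)).det ^ 2) ^ N := by
    rw [← hN (MvPolynomial.X : Fin e → Z) c (Equiv.refl _)]
    refine congrArg (fun M : Matrix ι ι Z => M.det ^ 2) (Matrix.ext fun μ ν => ?_)
    refine (map_prod (σ μ) _ _).trans (Finset.prod_congr rfl fun i _ => ?_)
    refine (map_pow (σ μ) _ _).trans (congrArg (· ^ (ν i : ℕ)) ?_)
    exact MvPolynomial.renameSymmetric_X _ _ _ _
  have hne : (Matrix.of fun i j => σ i (v j)).det ≠ 0 := by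
    have : ((Matrix.vandermonde (MvPolynomial.X : Fin e → Z)).det ^ 2) ^ N ≠ 0 :=
      pow_ne_zero _ (pow_ne_zero _
        (Matrix.det_vandermonde_ne_zero_iff.2 MvPolynomial.X_injective))
    rw [← hdet] at this
    exact (pow_ne_zero_iff two_ne_zero).1 this
  let b : Module.Basis ι S Z := Module.Basis.mk
    (linearIndependent_of_det_algHom_ne_zero v σ hne)
    (MvPolynomial.span_symmetricSubalgebra_monomials E e).ge
  have hb : ⇑b = v := Module.Basis.coe_mk _ _
  refine ⟨N, Associated.of_eq (Subtype.ext ?_)⟩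
  have h := Algebra.algebraMap_discr_eq_det_sq b σ (by rwa [hb])
  rw [hb, hdet] at h
  refine h.trans ?_
  simp only [Matrix.det_vandermonde, SubmonoidClass.coe_pow, ← Finset.prod_pow]
  refine (Finset.prod_congr rfl fun i _ => Finset.prod_congr rfl fun j _ => ?_)
  ring
end

section
/- Let E be an algebraically closed field of characteristic zero and let e be a positive natural number. For any a_1,…,a_e ∈ E, the quotient of Z = E[X_1,…,X_e] by the ideal generated by s_1 − a_1, …, s_e − a_e, where s_k is the k-th elementary symmetric polynomial, is a finite-dimensional E-vector space of dimension exactly e! (in Lean: Module.finrank E (MvPolynomial (Fin e) E ⧸ Ideal.span {s_k − C a_k | 1 ≤ k ≤ e}) = e !). -/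
open MvPolynomial

open Polynomial in
/-- An `R`-algebra `A` together with `x_1, …, x_n ∈ A` is a universal splitting of a polynomial
`p` over `R` if `p = ∏ (X - x_i)` over `A`, and `A` is generated by the `x_i` and maps to every
`R`-algebra over which `p` has such a factorization, compatibly with the factorizations. -/
structure IsUniversalSplitting.{u} {R A : Type u} [CommRing R] [CommRing A] [Algebra R A] {n : ℕ}
    (p : R[X]) (x : Fin n → A) : Prop where
  map_eq_prod : p.map (algebraMap R A) = ∏ i, (Polynomial.X - Polynomial.C (x i))
  adjoin_eq_top : Algebra.adjoin R (Set.range x) = ⊤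
  exists_algHom : ∀ (B : Type u) [CommRing B] [Algebra R B] (y : Fin n → B),
    p.map (algebraMap R B) = ∏ i, (Polynomial.X - Polynomial.C (y i)) →
      ∃ f : A →ₐ[R] B, ∀ i, f (x i) = y i

namespace IsUniversalSplitting

universe u

/-- Two universal splittings of the same polynomial are isomorphic. -/
theorem nonempty_algEquiv {R A A' : Type u} [CommRing R] [CommRing A] [Algebra R A] [CommRing A']
    [Algebra R A'] {n : ℕ} {p : Polynomial R} {x : Fin n → A} {x' : Fin n → A'}
    (h : IsUniversalSplitting p x) (h' : IsUniversalSplitting p x') : Nonempty (A ≃ₐ[R] A') := by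
  obtain ⟨f, hf⟩ := h.exists_algHom A' x' h'.map_eq_prod
  obtain ⟨g, hg⟩ := h'.exists_algHom A x h.map_eq_prod
  refine ⟨AlgEquiv.ofAlgHom f g ?_ ?_⟩
  · refine AlgHom.ext_of_adjoin_eq_top h'.adjoin_eq_top ?_
    rintro _ ⟨i, rfl⟩
    simp [hf, hg]
  · refine AlgHom.ext_of_adjoin_eq_top h.adjoin_eq_top ?_
    rintro _ ⟨i, rfl⟩
    simp [hf, hg]

/-- A universal splitting of the quotient of `p` by `X - r`, where `r` is the root of `p` in
`AdjoinRoot p`, is a universal splitting of `p`. -/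
theorem cons_root {R A : Type u} [CommRing R] [CommRing A] [Algebra R A] {n : ℕ}
    {p : Polynomial R} [Algebra (AdjoinRoot p) A] [IsScalarTower R (AdjoinRoot p) A]
    {q : Polynomial (AdjoinRoot p)}
    (hq : p.map (AdjoinRoot.of p) = (Polynomial.X - Polynomial.C (AdjoinRoot.root p)) * q)
    {x : Fin n → A} (h : IsUniversalSplitting q x) :
    IsUniversalSplitting p
      (Fin.cons (algebraMap (AdjoinRoot p) A (AdjoinRoot.root p)) x : Fin (n + 1) → A) where
  map_eq_prod := by
    rw [IsScalarTower.algebraMap_eq R (AdjoinRoot p) A, ← Polynomial.map_map,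
      AdjoinRoot.algebraMap_eq, hq, Fin.prod_univ_succ]
    simp [h.map_eq_prod]
  adjoin_eq_top := by
    rw [Fin.range_cons, ← Set.singleton_union, ← Set.image_singleton,
      ← Algebra.adjoin_eq_adjoin_union R _ _ AdjoinRoot.adjoinRoot_eq_top, h.adjoin_eq_top,
      Subalgebra.restrictScalars_top]
  exists_algHom B _ _ y hy := by
    rw [Fin.prod_univ_succ] at hy
    have hroot : Polynomial.aeval (y 0) p = 0 := by
      rw [← Polynomial.eval_map_algebraMap, hy]
      simp
    let g : AdjoinRoot p →ₐ[R] B := AdjoinRoot.liftAlgHom p (Algebra.ofId R B) (y 0) hroot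
    have hg : g (AdjoinRoot.root p) = y 0 := AdjoinRoot.liftAlgHom_root ..
    let := g.toRingHom.toAlgebra
    have : IsScalarTower R (AdjoinRoot p) B := .of_algebraMap_eq fun r => (g.commutes r).symm
    have hqy : q.map (algebraMap (AdjoinRoot p) B) =
        ∏ i : Fin n, (Polynomial.X - Polynomial.C (y i.succ)) := by
      refine (Polynomial.monic_X_sub_C (y 0)).isRegular.left ?_
      have := congrArg (Polynomial.map (algebraMap (AdjoinRoot p) B)) hq
      rw [Polynomial.map_map, ← AdjoinRoot.algebraMap_eq, ← IsScalarTower.algebraMap_eq, hy,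
        Polynomial.map_mul, Polynomial.map_sub, Polynomial.map_X, Polynomial.map_C,
        show algebraMap (AdjoinRoot p) B (AdjoinRoot.root p) = y 0 from hg] at this
      exact this.symm
    obtain ⟨f, hf⟩ := h.exists_algHom B (fun i => y i.succ) hqy
    refine ⟨f.restrictScalars R, Fin.cases ?_ fun i => ?_⟩
    · exact (f.commutes _).trans hg
    · simpa using hf i

/-- A monic polynomial of degree `n` has a universal splitting which is free of rank `n!`. -/
theorem exists_free_finrank_eq_factorial (n : ℕ) :
    ∀ (R : Type u) [CommRing R] [Nontrivial R] (p : Polynomial R), p.Monic → p.natDegree = n →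
      ∃ (A : Type u) (_ : CommRing A) (_ : Algebra R A) (x : Fin n → A),
        IsUniversalSplitting p x ∧ Module.Free R A ∧ Module.finrank R A = n.factorial := by
  induction n with
  | zero =>
    intro R _ _ p hp hn
    obtain rfl := hp.natDegree_eq_zero.mp hn
    refine ⟨R, inferInstance, inferInstance, Fin.elim0, ⟨by simp, ?_, ?_⟩, inferInstance, by simp⟩
    · exact Subsingleton.elim _ _
    · exact fun B _ _ y _ => ⟨Algebra.ofId R B, fun i => i.elim0⟩
  | succ n ih =>
    intro R _ _ p hp hn
    have hfree : Module.Free R (AdjoinRoot p) := .of_basis (AdjoinRoot.powerBasis' hp).basis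
    have hrank : Module.finrank R (AdjoinRoot p) = n + 1 := by
      rw [(AdjoinRoot.powerBasis' hp).finrank, AdjoinRoot.powerBasis'_dim, hn]
    have : Nontrivial (AdjoinRoot p) :=
      Module.nontrivial_of_finrank_pos (R := R) (by omega)
    have hq := (Polynomial.mul_divByMonic_eq_iff_isRoot.mpr (AdjoinRoot.isRoot_root p)).symm
    set q := p.map (AdjoinRoot.of p) /ₘ (Polynomial.X - Polynomial.C (AdjoinRoot.root p))
    have hqm : q.Monic :=
      (Polynomial.monic_X_sub_C _).of_mul_monic_left (hq ▸ hp.map (AdjoinRoot.of p))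
    have hqn : q.natDegree = n := by
      rw [Polynomial.natDegree_divByMonic _ (Polynomial.monic_X_sub_C _), hp.natDegree_map, hn,
        Polynomial.natDegree_X_sub_C, Nat.add_sub_cancel]
    obtain ⟨A, _, _, x, hx, _, hA⟩ := ih (AdjoinRoot p) q hqm hqn
    let : Algebra R A := Algebra.compHom A (AdjoinRoot.of p)
    have : IsScalarTower R (AdjoinRoot p) A := .of_algebraMap_eq fun _ => rfl
    refine ⟨A, inferInstance, inferInstance, _, hx.cons_root hq,
      Module.Free.trans (S := AdjoinRoot p), ?_⟩
    rw [← Module.finrank_mul_finrank R (AdjoinRoot p) A, hrank, hA, Nat.factorial_succ]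

end IsUniversalSplitting

section Vieta

open Finset

/-- The polynomial `∑ (-1)^j c_j X^(n-j)`, whose coefficients up to sign are `c_0, …, c_n`. -/
noncomputable def alternatingSumPolynomial {R : Type*} [CommRing R] (n : ℕ) (c : ℕ → R) :
    Polynomial R :=
  ∑ j ∈ range (n + 1), (-1) ^ j * (Polynomial.C (c j) * Polynomial.X ^ (n - j))

variable {R : Type*} [CommRing R] {n : ℕ}

theorem coeff_alternatingSumPolynomial (c : ℕ → R) {k : ℕ} (hk : k ≤ n) :
    (alternatingSumPolynomial n c).coeff (n - k) = (-1) ^ k * c k := by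
  have hC (j : ℕ) : ((-1) ^ j : Polynomial R) = Polynomial.C ((-1) ^ j) := by simp
  rw [alternatingSumPolynomial, Polynomial.finsetSum_coeff, sum_eq_single k]
  · simp [hC, -map_pow]
  · intro j hj hjk
    rw [hC, Polynomial.coeff_C_mul, Polynomial.coeff_C_mul_X_pow, if_neg, mul_zero]
    have := mem_range.mp hj
    omega
  · intro h
    exact absurd (mem_range.mpr (by omega)) h

theorem natDegree_alternatingSumPolynomial_le (c : ℕ → R) :
    (alternatingSumPolynomial n c).natDegree ≤ n := by
  refine Polynomial.natDegree_sum_le_of_forall_le _ _ fun j _ => ?_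
  rw [← Polynomial.C_1, ← Polynomial.C_neg, ← Polynomial.C_pow, ← mul_assoc, ← Polynomial.C_mul]
  exact (Polynomial.natDegree_C_mul_X_pow_le _ _).trans (Nat.sub_le n j)

theorem monic_alternatingSumPolynomial {c : ℕ → R} (hc : c 0 = 1) :
    (alternatingSumPolynomial n c).Monic :=
  Polynomial.monic_of_natDegree_le_of_coeff_eq_one n (natDegree_alternatingSumPolynomial_le c)
    (by simpa [hc] using coeff_alternatingSumPolynomial c (Nat.zero_le n))

theorem natDegree_alternatingSumPolynomial [Nontrivial R] {c : ℕ → R} (hc : c 0 = 1) :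
    (alternatingSumPolynomial n c).natDegree = n := by
  refine (natDegree_alternatingSumPolynomial_le c).antisymm (Polynomial.le_natDegree_of_ne_zero ?_)
  simpa [hc] using (coeff_alternatingSumPolynomial c (Nat.zero_le n)).trans_ne (by simp [hc])

theorem alternatingSumPolynomial_inj {c d : ℕ → R} :
    alternatingSumPolynomial n c = alternatingSumPolynomial n d ↔ ∀ k ≤ n, c k = d k := by
  refine ⟨fun h k hk => ?_, fun h => sum_congr rfl fun j hj => ?_⟩
  · have := congrArg (Polynomial.coeff · (n - k)) h
    simp only [coeff_alternatingSumPolynomial _ hk] at this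
    exact ((isUnit_one.neg).pow k).mul_left_cancel this
  · rw [h j (by have := mem_range.mp hj; omega)]

theorem map_alternatingSumPolynomial {S : Type*} [CommRing S] (f : R →+* S) (c : ℕ → R) :
    (alternatingSumPolynomial n c).map f = alternatingSumPolynomial n (f ∘ c) := by
  simp [alternatingSumPolynomial, Polynomial.map_sum]

theorem prod_X_sub_C_eq_alternatingSumPolynomial (R : Type*) [CommRing R] {S : Type*} [CommRing S]
    [Algebra R S] (y : Fin n → S) :
    ∏ i, (Polynomial.X - Polynomial.C (y i)) =
      alternatingSumPolynomial n fun k => aeval y (esymm (Fin n) R k) := by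
  have := Multiset.prod_X_sub_X_eq_sum_esymm (univ.val.map y)
  simpa [alternatingSumPolynomial, aeval_esymm_eq_multiset_esymm, Finset.prod,
    Function.comp_def] using this

/-- Vieta's formulas, as a characterization of the factorizations of a monic polynomial. -/
theorem map_alternatingSumPolynomial_eq_prod_iff {S : Type*} [CommRing S] [Algebra R S]
    {c : ℕ → R} (hc : c 0 = 1) (y : Fin n → S) :
    (alternatingSumPolynomial n c).map (algebraMap R S) =
        ∏ i, (Polynomial.X - Polynomial.C (y i)) ↔
      ∀ k ∈ Set.Icc 1 n, aeval y (esymm (Fin n) R k - C (c k)) = 0 := by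
  rw [map_alternatingSumPolynomial, prod_X_sub_C_eq_alternatingSumPolynomial R,
    alternatingSumPolynomial_inj]
  simp only [map_sub, aeval_C, sub_eq_zero, Function.comp_apply]
  refine ⟨fun h k hk => (h k hk.2).symm, fun h k hk => ?_⟩
  rcases Nat.eq_zero_or_pos k with rfl | hk0
  · simp [hc]
  · exact (h k ⟨hk0, hk⟩).symm

end Vieta

/-- Imposing the values of the elementary symmetric polynomials on the variables yields a universal
splitting of the monic polynomial with the corresponding coefficients. -/
theorem isUniversalSplitting_mk_X {R : Type*} [CommRing R] {n : ℕ} {c : ℕ → R} (hc : c 0 = 1) :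
    IsUniversalSplitting (alternatingSumPolynomial n c) fun i : Fin n =>
      Ideal.Quotient.mkₐ R
        (Ideal.span ((fun k => esymm (Fin n) R k - C (c k)) '' Set.Icc 1 n)) (X i) where
  map_eq_prod := by
    rw [map_alternatingSumPolynomial_eq_prod_iff hc]
    intro k hk
    rw [← comp_aeval_apply, aeval_X_left_apply, Ideal.Quotient.mkₐ_eq_mk,
      Ideal.Quotient.eq_zero_iff_mem]
    exact Ideal.subset_span ⟨k, hk, rfl⟩
  adjoin_eq_top := by
    rw [Set.range_comp' _ X, ← AlgHom.map_adjoin, adjoin_range_X, Algebra.map_top,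
      AlgHom.range_eq_top]
    exact Ideal.Quotient.mkₐ_surjective _ _
  exists_algHom B _ _ y hy := by
    rw [map_alternatingSumPolynomial_eq_prod_iff hc] at hy
    refine ⟨Ideal.Quotient.liftₐ _ (aeval y) fun p hp => ?_, fun i => ?_⟩
    · rw [← RingHom.mem_ker]
      refine Ideal.span_le.mpr ?_ hp
      rintro _ ⟨k, hk, rfl⟩
      exact hy k hk
    · exact aeval_X y i

/-- Over an algebraically closed field `E` of characteristic zero, for any
`a_1, …, a_e ∈ E` the quotient of `E[X_1, …, X_e]` by the ideal generated by the
`s_k - a_k` (`s_k` the `k`-th elementary symmetric polynomial, `1 ≤ k ≤ e`) is an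
`E`-vector space of dimension exactly `e!`. -/
theorem finrank_quotient_span_esymm_sub_eq_factorial
    (E : Type*) [Field E] [IsAlgClosed E] [CharZero E] (e : ℕ) (he : 0 < e) (a : ℕ → E) :
    Module.finrank E
      (MvPolynomial (Fin e) E ⧸
        Ideal.span ((fun k => esymm (Fin e) E k - C (a k)) '' Set.Icc 1 e)) =
      Nat.factorial e := by
  have hc : Function.update a 0 1 0 = 1 := Function.update_self ..
  obtain ⟨A, _, _, x, hx, _, hA⟩ := IsUniversalSplitting.exists_free_finrank_eq_factorial e E _
    (monic_alternatingSumPolynomial hc) (natDegree_alternatingSumPolynomial hc)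
  obtain ⟨f⟩ := (isUniversalSplitting_mk_X hc).nonempty_algEquiv hx
  have himage : (fun k => esymm (Fin e) E k - C (a k)) '' Set.Icc 1 e =
      (fun k => esymm (Fin e) E k - C (Function.update a 0 1 k)) '' Set.Icc 1 e :=
    Set.image_congr fun k hk => by
      rw [Function.update_of_ne (Nat.one_le_iff_ne_zero.mp hk.1)]
  rw [himage, f.toLinearEquiv.finrank_eq, hA]
end

section
/- Let A be a commutative ring, let G be a finite group acting on A by ring automorphisms, and let f ∈ A be fixed by every element of G. Let B be a commutative ring equipped with an A-algebra structure making it a localization of A away from f (IsLocalization.Away f B), and suppose B carries an action of G by ring automorphisms such that the structure map A → B is G-equivariant (g·(algebraMap A B a) = algebraMap A B (g·a) for all g, a). Then the subring of G-invariants B^G, regarded as an algebra over the subring of G-invariants A^G via the restriction of the structure map, is a localization of A^G away from f (where f is viewed as an element of A^G); that is, IsLocalization.Away holds for the element f of A^G and the A^G-algebra B^G. In particular (A_f)^G ≅ (A^G)_f. -/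
/-- The fixed-point subring `A^G` of a ring `A` under an action of a group `G` by
ring automorphisms. -/
def fixedSubring (G A : Type*) [Monoid G] [Ring A] [MulSemiringAction G A] : Subring A where
  carrier := MulAction.fixedPoints G A
  mul_mem' := fun {a b} ha hb g => by rw [smul_mul', ha g, hb g]
  one_mem' := fun g => smul_one g
  add_mem' := fun {a b} ha hb g => by rw [smul_add, ha g, hb g]
  zero_mem' := fun g => smul_zero g
  neg_mem' := fun {a} ha g => by rw [smul_neg, ha g]

/-- The ring homomorphism `A^G → B^G` obtained by restricting a `G`-equivariant
structure map `A → B` to the fixed-point subrings. -/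
def fixedSubringMap (G A B : Type*) [Group G] [CommRing A] [CommRing B] [Algebra A B]
    [MulSemiringAction G A] [MulSemiringAction G B]
    (hequiv : ∀ (g : G) (a : A), g • (algebraMap A B a) = algebraMap A B (g • a)) :
    fixedSubring G A →+* fixedSubring G B where
  toFun a := ⟨algebraMap A B a.1, fun g => by rw [hequiv g a.1, a.2 g]⟩
  map_one' := Subtype.ext (map_one _)
  map_mul' x y := Subtype.ext (map_mul _ _ _)
  map_zero' := Subtype.ext (map_zero _)
  map_add' x y := Subtype.ext (map_add _ _ _)

/-- If the image of `a` in a localization away from a fixed element `f` agrees with the image of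
every translate `g • a`, then `f ^ n * a` is itself fixed for some `n`. -/
theorem exists_pow_mul_fixed {G A B : Type*} [Group G] [Finite G] [CommRing A] [CommRing B]
    [Algebra A B] [MulSemiringAction G A] {f : A} (hfix : ∀ g : G, g • f = f)
    [IsLocalization.Away f B] {a : A}
    (ha : ∀ g : G, algebraMap A B (g • a) = algebraMap A B a) :
    ∃ n : ℕ, ∀ g : G, g • (f ^ n * a) = f ^ n * a := by
  cases nonempty_fintype G
  choose n hn using fun g => IsLocalization.Away.exists_of_eq f (ha g)
  refine ⟨∑ g, n g, fun g => ?_⟩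
  obtain ⟨k, hk⟩ := Nat.exists_eq_add_of_le'
    (Finset.single_le_sum (f := n) (fun _ _ => Nat.zero_le _) (Finset.mem_univ g))
  rw [smul_mul', smul_pow', hfix, hk, pow_add, mul_assoc, mul_assoc, hn g]

/-- If a finite group `G` acts on `A` fixing `f`, and acts compatibly on a
localization `B` of `A` away from `f`, then `B^G` is a localization of `A^G` away from
`f`; in particular `(A_f)^G ≅ (A^G)_f`. -/
theorem isLocalization_away_fixedPoints
    (G A B : Type*) [Group G] [Finite G] [CommRing A] [CommRing B] [Algebra A B]
    [MulSemiringAction G A] [MulSemiringAction G B]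
    (f : A) (hfix : ∀ g : G, g • f = f) [IsLocalization.Away f B]
    (hequiv : ∀ (g : G) (a : A), g • (algebraMap A B a) = algebraMap A B (g • a)) :
    letI : Algebra (fixedSubring G A) (fixedSubring G B) :=
      (fixedSubringMap G A B hequiv).toAlgebra
    IsLocalization.Away (⟨f, hfix⟩ : fixedSubring G A) (fixedSubring G B) := by
  let _ : Algebra (fixedSubring G A) (fixedSubring G B) :=
    (fixedSubringMap G A B hequiv).toAlgebra
  have hfB (g : G) : g • algebraMap A B f = algebraMap A B f := by rw [hequiv, hfix]
  refine IsLocalization.Away.mk _ ?_ ?_ ?_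
  · obtain ⟨u, hu⟩ :=
      (IsLocalization.Away.algebraMap_isUnit (S := B) f).exists_right_inv
    have hu_fix (g : G) : g • u = u := by
      have h : algebraMap A B f * (g • u) = 1 := by
        rw [← hfB g, ← smul_mul', hu, smul_one]
      exact (IsLocalization.Away.algebraMap_isUnit f).mul_left_cancel (h.trans hu.symm)
    exact IsUnit.of_mul_eq_one (⟨u, hu_fix⟩ : fixedSubring G B) (Subtype.ext hu)
  · rintro ⟨b, hb⟩
    obtain ⟨m, a, ha⟩ := IsLocalization.Away.surj f b
    have ha_fix (g : G) : algebraMap A B (g • a) = algebraMap A B a := by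
      rw [← hequiv, ← ha, smul_mul', smul_pow', hfB, hb g]
    obtain ⟨n, hn⟩ := exists_pow_mul_fixed hfix ha_fix
    refine ⟨m + n, ⟨f ^ n * a, hn⟩, Subtype.ext ?_⟩
    change b * algebraMap A B f ^ (m + n) = algebraMap A B (f ^ n * a)
    rw [map_mul, map_pow, ← ha]
    ring
  · intro a b hab
    obtain ⟨n, hn⟩ := IsLocalization.Away.exists_of_eq (S := B) f (congrArg Subtype.val hab)
    exact ⟨n, Subtype.ext hn⟩
end

section
/- Let E be a field, let A be a commutative E-algebra of finite type (finitely generated as an E-algebra), and let G be a finite group acting on A by E-algebra automorphisms. Then A is a finitely generated module over its fixed-point subalgebra A^G (in Lean: Module.Finite A^G A). -/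
/-- The fixed-point subalgebra `A^G` of an `E`-algebra `A` under an action of a group `G`
by `E`-algebra automorphisms. -/
def fixedSubalgebra (E G A : Type*) [CommSemiring E] [Semiring A] [Algebra E A]
    [Monoid G] [MulSemiringAction G A] [SMulCommClass G E A] : Subalgebra E A where
  carrier := MulAction.fixedPoints G A
  mul_mem' := fun {a b} ha hb g => by rw [smul_mul', ha g, hb g]
  add_mem' := fun {a b} ha hb g => by rw [smul_add, ha g, hb g]
  algebraMap_mem' := fun r g => smul_algebraMap g r

/-- If `A` is a commutative `E`-algebra of finite type and a finite group `G`
acts on `A` by `E`-algebra automorphisms, then `A` is a finitely generated module over the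
fixed-point subalgebra `A^G`. -/
theorem module_finite_over_fixedSubalgebra
    (E A G : Type*) [Field E] [CommRing A] [Algebra E A] [Algebra.FiniteType E A]
    [Group G] [Finite G] [MulSemiringAction G A] [SMulCommClass G E A] :
    Module.Finite (fixedSubalgebra E G A) A := by
  have : Algebra.IsInvariant (fixedSubalgebra E G A) A G := ⟨fun b hb => ⟨⟨b, hb⟩, rfl⟩⟩
  have : Algebra.IsIntegral (fixedSubalgebra E G A) A := Algebra.IsInvariant.isIntegral _ A G
  have : Algebra.FiniteType (fixedSubalgebra E G A) A :=
    .of_restrictScalars_finiteType E _ A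
  exact Algebra.IsIntegral.finite
end

section
/- Let R be a commutative ring and let M be a finitely generated projective R-module, so that for every prime ideal p of R the localization M_p is a finite free module over the local ring R_p. Let n be a natural number and let T be a dense subset of the prime spectrum PrimeSpectrum R (with the Zariski topology). If for every p ∈ T the rank of M_p over R_p equals n, then for every prime ideal p of R the rank of M_p over R_p equals n; that is, the local rank function of M is constant equal to n on all of Spec R. -/
/-- Let `M` be a finitely generated projective module over a commutative
ring `R`. If the local rank of `M` equals `n` at every point of a dense subset `T` of
`Spec R`, then the local rank of `M` equals `n` at every point of `Spec R`. -/
theorem rankAtStalk_eq_of_dense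
    (R M : Type*) [CommRing R] [AddCommGroup M] [Module R M]
    [Module.Finite R M] [Module.Projective R M]
    (n : ℕ) (T : Set (PrimeSpectrum R)) (hT : Dense T)
    (h : ∀ p ∈ T, Module.rankAtStalk (R := R) M p = n) :
    ∀ p : PrimeSpectrum R, Module.rankAtStalk (R := R) M p = n := by
  have : Module.FinitePresentation R M := Module.finitePresentation_of_projective R M
  have hc : Continuous (Module.rankAtStalk (R := R) M) :=
    Module.isLocallyConstant_rankAtStalk.continuous
  exact congrFun (hc.ext_on hT continuous_const h)
end
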